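/- Let Φ be a based root system of rank 3 (i.e., |Δ| = 3) which is clean. Then (Φ, Φ⁺) has a unique oriented matroid root system structure: if (Φ, α ↦ −α, d) is any OMRS on (Φ, Φ⁺), then d(X) = cone(X) ∩ Φ for every subset X ⊆ Φ, i.e., d coincides with the RRS oriented matroid closure cone_Φ. -/

import Mathlib

open Set Pointwise

variable {V : Type*} [AddCommGroup V] [Module ℝ V]

/-- `cone X` is the set of all finite nonnegative linear combinations of elements of `X`. -/
def cone (X : Set V) : Set V :=
  {v | ∃ (n : ℕ) (c : Fin n → ℝ) (x : Fin n → V),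
    (∀ i, 0 ≤ c i) ∧ (∀ i, x i ∈ X) ∧ v = ∑ i, c i • x i}

/-- An oriented matroid structure on the ground set `E ⊆ V`, with involution `x ↦ -x`
and closure operator `d` (only its values on subsets of `E` are relevant). -/
structure IsOrientedMatroidOn (E : Set V) (d : Set V → Set V) : Prop where
  neg_mem : ∀ x ∈ E, -x ∈ E
  neg_ne : ∀ x ∈ E, -x ≠ x
  cx_le_ground : ∀ X, X ⊆ E → d X ⊆ E
  le_cx : ∀ X, X ⊆ E → X ⊆ d X
  cx_mono : ∀ X Y : Set V, X ⊆ Y → Y ⊆ E → d X ⊆ d Y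
  cx_idem : ∀ X, X ⊆ E → d (d X) = d X
  cx_neg : ∀ X, X ⊆ E → d (-X) = -(d X)
  exchange2 : ∀ X, X ⊆ E → ∀ x ∈ E, x ∈ d (X ∪ {-x}) → x ∈ d X
  exchange3 : ∀ X, X ⊆ E → ∀ x ∈ E, ∀ y ∈ E,
    x ∈ d (X ∪ {-y}) → x ∉ d X → y ∈ d ((X \ {y}) ∪ {-x})
  finitary : ∀ X, X ⊆ E → ∀ x ∈ d X, ∃ Y, Y ⊆ X ∧ Y.Finite ∧ x ∈ d Y

/-- The oriented matroid is reduced: `d ∅ = ∅` and `d {x} = {x}` for `x ∈ E`. -/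
def IsReducedOn (E : Set V) (d : Set V → Set V) : Prop :=
  d ∅ = ∅ ∧ ∀ x ∈ E, d {x} = {x}

/-- A tope: a maximal `d`-closed asymmetric subset of `E`. -/
def IsTope (E : Set V) (d : Set V → Set V) (R : Set V) : Prop :=
  R ⊆ E ∧ d R ⊆ R ∧ (∀ x ∈ R, -x ∉ R) ∧
    ∀ R' : Set V, R' ⊆ E → d R' ⊆ R' → (∀ x ∈ R', -x ∉ R') → R ⊆ R' → R' = R

/-- The simple reflections `s_α : v ↦ v - 2B(v,α)α` for `α ∈ Δ`. -/
def simpleReflections (B : LinearMap.BilinForm ℝ V) (Δ : Set V) : Set (V ≃ₗ[ℝ] V) :=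
  {g | ∃ α ∈ Δ, ∀ v : V, g v = v - (2 * B v α) • α}

/-- The Weyl group generated by the simple reflections. -/
def weylGroup (B : LinearMap.BilinForm ℝ V) (Δ : Set V) : Subgroup (V ≃ₗ[ℝ] V) :=
  Subgroup.closure (simpleReflections B Δ)

/-- The root system `Φ = W·Δ`. -/
def rootSystem (B : LinearMap.BilinForm ℝ V) (Δ : Set V) : Set V :=
  {v | ∃ w ∈ weylGroup B Δ, ∃ α ∈ Δ, v = w α}

/-- The positive roots `Φ⁺ = Φ ∩ cone(Δ)`. -/
def positiveRoots (B : LinearMap.BilinForm ℝ V) (Δ : Set V) : Set V :=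
  rootSystem B Δ ∩ cone Δ

/-- A based root system with simple roots `Δ` and symmetric bilinear form `B`. -/
structure IsBasedRootSystem (B : LinearMap.BilinForm ℝ V) (Δ : Set V) : Prop where
  finite : Δ.Finite
  indep : LinearIndependent ℝ ((↑) : Δ → V)
  symm : ∀ u v : V, B u v = B v u
  diag_one : ∀ α ∈ Δ, B α α = 1
  offdiag : ∀ α ∈ Δ, ∀ β ∈ Δ, α ≠ β →
    (∃ m : ℕ, 2 ≤ m ∧ B α β = -Real.cos (Real.pi / (m : ℝ))) ∨ B α β ≤ -1

/-- An oriented matroid root system (OMRS) on `(Φ, Φ⁺)`. -/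
structure IsOMRS (B : LinearMap.BilinForm ℝ V) (Δ : Set V) (d : Set V → Set V) : Prop where
  om : IsOrientedMatroidOn (rootSystem B Δ) d
  reduced : IsReducedOn (rootSystem B Δ) d
  equivariant : ∀ w ∈ weylGroup B Δ, ∀ X, X ⊆ rootSystem B Δ → d (⇑w '' X) = ⇑w '' d X
  positive_closed : d (positiveRoots B Δ) = positiveRoots B Δ
  rank_two : ∀ X, X ⊆ rootSystem B Δ →
    Module.rank ℝ ↥(Submodule.span ℝ X) ≤ 2 → d X = cone X ∩ rootSystem B Δ

/-- `A` is `c₂`-closed in `P`. -/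
def C2Closed (P A : Set V) : Prop :=
  ∀ α ∈ A, ∀ β ∈ A, ∀ γ ∈ P, γ ∈ cone {α, β} → γ ∈ A

/-- `A` is `c₂`-biclosed in `P`. -/
def C2Biclosed (P A : Set V) : Prop :=
  C2Closed P A ∧ C2Closed P (P \ A)

/-- A root system is clean if every `c₂`-biclosed set of positive roots gives a tope of
the RRS oriented matroid `(Φ, -, cone_Φ)`. -/
def IsClean (B : LinearMap.BilinForm ℝ V) (Δ : Set V) : Prop :=
  ∀ A, A ⊆ positiveRoots B Δ → C2Biclosed (positiveRoots B Δ) A →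
    IsTope (rootSystem B Δ) (fun X => cone X ∩ rootSystem B Δ)
      (A ∪ (-(positiveRoots B Δ \ A)))


section OM
variable {E : Set V} {d : Set V → Set V}

lemma om_tr (h : IsOrientedMatroidOn E d) {X Y : Set V} (hY : Y ⊆ E) (hXY : X ⊆ d Y) :
    d X ⊆ d Y := by
  have := h.cx_mono X (d Y) hXY (h.cx_le_ground Y hY)
  rwa [h.cx_idem Y hY] at this

lemma om_negset (h : IsOrientedMatroidOn E d) {X : Set V} (hX : X ⊆ E) : -X ⊆ E := by
  intro x hx
  have := h.neg_mem _ (hX hx)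
  simpa using this

/-- Caratheodory-type lemma. -/
lemma om_minimal (h : IsOrientedMatroidOn E d) {X : Set V} (hX : X ⊆ E) {z : V} (hzE : z ∈ E)
    (hz : z ∈ d X) (hmin : ∀ e ∈ X, z ∉ d (X \ {e})) {N : Set V} (hN : N.Finite) :
    N ⊆ X → ∀ e ∈ X, z ∉ d ((X \ {e}) ∪ -N) := by
  induction N, hN using Set.Finite.induction_on with
  | empty => intro _ e he; simpa using hmin e he
  | @insert f N hf hN ih =>
    intro hNX e he hz'
    have hNX' : N ⊆ X := (Set.subset_insert _ _).trans hNX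
    have hfX : f ∈ X := hNX (Set.mem_insert _ _)
    have hnN : -N ⊆ E := om_negset h (hNX'.trans hX)
    have hXd : ∀ e, X \ {e} ⊆ E := fun e => Set.sdiff_subset.trans hX
    have e1 : (X \ {e}) ∪ -(insert f N) = ((X \ {e}) ∪ -N) ∪ {-f} := by
      ext x; simp
    rw [e1] at hz'
    have h3 := h.exchange3 _ (Set.union_subset (hXd e) hnN) z hzE f (hX hfX) hz' (ih hNX' e he)
    have hG : (X \ {f}) ∪ -N ∪ {-z} ⊆ E :=
      Set.union_subset (Set.union_subset (hXd f) hnN) (by simpa using h.neg_mem z hzE)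
    have hfG : f ∈ d ((X \ {f}) ∪ -N ∪ {-z}) := by
      refine h.cx_mono _ _ ?_ hG h3
      intro x hx
      simp only [Set.mem_union, Set.mem_sdiff, Set.mem_singleton_iff] at hx ⊢
      tauto
    have hXG : X ⊆ d ((X \ {f}) ∪ -N ∪ {-z}) := by
      intro x hx
      by_cases hxf : x = f
      · rw [hxf]; exact hfG
      · exact h.le_cx _ hG (Or.inl (Or.inl ⟨hx, hxf⟩))
    have := om_tr h hG hXG hz
    exact ih hNX' f hfX (h.exchange2 _ (Set.union_subset (hXd f) hnN) z hzE this)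

lemma om_chain (h : IsOrientedMatroidOn E d) {c : Set (Set V)} (hc : IsChain (· ⊆ ·) c)
    (hne : c.Nonempty) (hE : ∀ s ∈ c, s ⊆ E) (hcl : ∀ s ∈ c, d s ⊆ s) : d (⋃₀ c) ⊆ ⋃₀ c := by
  intro x hx
  obtain ⟨Y, hY, hfin, hxY⟩ := h.finitary _ (Set.sUnion_subset hE) x hx
  obtain ⟨s, hs, hYs⟩ := hc.directedOn.exists_mem_subset_of_finite_of_subset_sUnion hne hfin hY
  exact ⟨s, hs, hcl s hs (h.cx_mono _ _ hYs (hE s hs) hxY)⟩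

/-- Separation by a half-space. -/
lemma om_halfspace (h : IsOrientedMatroidOn E d) {X : Set V} (hX : X ⊆ E) {x : V} (hxE : x ∈ E)
    (hx : x ∉ d X) : ∃ Y, X ⊆ Y ∧ Y ⊆ E ∧ d Y ⊆ Y ∧ x ∉ Y ∧ ∀ y ∈ E, y ∈ Y ∨ -y ∈ Y := by
  obtain ⟨Y, hXY, hmax⟩ := zorn_subset_nonempty {Y | Y ⊆ E ∧ d Y ⊆ Y ∧ x ∉ Y} (by
    intro c hc hch hne
    refine ⟨⋃₀ c, ⟨Set.sUnion_subset fun s hs => (hc hs).1,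
      om_chain h hch hne (fun s hs => (hc hs).1) (fun s hs => (hc hs).2.1), ?_⟩,
      fun s hs => Set.subset_sUnion_of_mem hs⟩
    rintro ⟨s, hs, hxs⟩
    exact (hc hs).2.2 hxs) (d X) ⟨h.cx_le_ground X hX, (h.cx_idem X hX).le, hx⟩
  obtain ⟨hYE, hYc, hxY⟩ := hmax.prop
  refine ⟨Y, (h.le_cx X hX).trans hXY, hYE, hYc, hxY, ?_⟩
  have key : ∀ y ∈ E, y ∉ Y → x ∈ d (Y ∪ {y}) := by
    intro y hy hyY
    by_contra hcon
    have hYy : Y ∪ {y} ⊆ E := Set.union_subset hYE (by simpa using hy)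
    have hle : Y ⊆ d (Y ∪ {y}) := Set.subset_union_left.trans (h.le_cx _ hYy)
    have := hmax.le_of_ge (y := d (Y ∪ {y}))
      ⟨h.cx_le_ground _ hYy, (h.cx_idem _ hYy).le, hcon⟩ hle
    exact hyY (this (h.le_cx _ hYy (Or.inr rfl)))
  intro y hy
  by_contra! hcon
  have hxd : x ∉ d Y := fun hh => hxY (hYc hh)
  have h1 := key y hy hcon.1
  have h2 := key (-y) (h.neg_mem y hy) hcon.2
  have h3 := h.exchange3 Y hYE x hxE y hy h2 hxd
  have hYx : Y ∪ {-x} ⊆ E := Set.union_subset hYE (by simpa using h.neg_mem x hxE)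
  have h4 : y ∈ d (Y ∪ {-x}) :=
    h.cx_mono _ _ (Set.union_subset_union_left _ Set.sdiff_subset) hYx h3
  have h5 : x ∈ d (Y ∪ {-x}) := by
    refine om_tr h hYx ?_ h1
    rintro u (hu | hu)
    · exact h.le_cx _ hYx (Or.inl hu)
    · rw [Set.mem_singleton_iff.1 hu]; exact h4
  exact hxd (h.exchange2 Y hYE x hxE h5)

/-- Extension of an asymmetric closed set to a tope of a flat `F`. -/
lemma om_tope_in (h : IsOrientedMatroidOn E d) {F X : Set V} (hF : F ⊆ E) (hFc : d F ⊆ F)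
    (hFn : ∀ y ∈ F, -y ∈ F)
    (hX : X ⊆ F) (hasym : ∀ y ∈ d X, -y ∉ d X) :
    ∃ T, X ⊆ T ∧ T ⊆ F ∧ d T ⊆ T ∧ (∀ y ∈ T, -y ∉ T) ∧ ∀ y ∈ F, y ∈ T ∨ -y ∈ T := by
  have hXE := hX.trans hF
  obtain ⟨T, hXT, hmax⟩ := zorn_subset_nonempty {T | T ⊆ F ∧ d T ⊆ T ∧ ∀ y ∈ T, -y ∉ T} (by
    intro c hc hch hne
    refine ⟨⋃₀ c, ⟨Set.sUnion_subset fun s hs => (hc hs).1,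
      om_chain h hch hne (fun s hs => (hc hs).1.trans hF) (fun s hs => (hc hs).2.1), ?_⟩,
      fun s hs => Set.subset_sUnion_of_mem hs⟩
    rintro y ⟨s, hs, hys⟩ ⟨t, ht, hyt⟩
    rcases hch.total hs ht with hst | hst
    · exact (hc ht).2.2 y (hst hys) hyt
    · exact (hc hs).2.2 y hys (hst hyt)) (d X)
      ⟨(h.cx_mono _ _ hX hF).trans hFc, (h.cx_idem X hXE).le, hasym⟩
  obtain ⟨hTF, hTc, hTa⟩ := hmax.prop
  refine ⟨T, (h.le_cx X hXE).trans hXT, hTF, hTc, hTa, ?_⟩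
  have hTE := hTF.trans hF
  intro y hy
  by_contra! hcon
  have hTy : T ∪ {y} ⊆ E := Set.union_subset hTE (by simpa using hF hy)
  have hTyF : T ∪ {y} ⊆ F := Set.union_subset hTF (by simpa using hy)
  -- if some `u, -u` are in the closure, then `-y ∈ T`
  have key : ∀ u, u ∈ d (T ∪ {y}) → -u ∈ d (T ∪ {y}) → u ∈ T := by
    intro u hu hnu
    by_contra huT
    have huE : u ∈ E := h.cx_le_ground _ hTy hu
    have h3 := h.exchange3 T hTE u huE (-y) (h.neg_mem _ (hF hy)) (by simpa using hu)
      (fun hh => huT (hTc hh))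
    have h4 : -y ∈ d (T ∪ {y}) := by
      refine om_tr h hTy ?_ h3
      rintro v (hv | hv)
      · exact h.le_cx _ hTy (Or.inl hv.1)
      · rw [Set.mem_singleton_iff.1 hv]; exact hnu
    exact hcon.2 (hTc (h.exchange2 T hTE (-y) (h.neg_mem _ (hF hy)) (by simpa using h4)))
  have := hmax.le_of_ge (y := d (T ∪ {y}))
      ⟨(h.cx_mono _ _ hTyF hF).trans hFc, (h.cx_idem _ hTy).le, fun u hu hnu =>
        hTa u (key u hu hnu) (key (-u) hnu (by simpa using hu))⟩
      (Set.subset_union_left.trans (h.le_cx _ hTy))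
  exact hcon.1 (this (h.le_cx _ hTy (Or.inr rfl)))

/-- A tope separating `x` from `X`, when the closure of `X` is asymmetric. -/
lemma om_sep_tope (h : IsOrientedMatroidOn E d) {X : Set V} (hX : X ⊆ E) {x : V} (hxE : x ∈ E)
    (hx : x ∉ d X) (hasym : ∀ y ∈ d X, -y ∉ d X) :
    ∃ R, X ⊆ R ∧ R ⊆ E ∧ d R ⊆ R ∧ (∀ y ∈ R, -y ∉ R) ∧ (∀ y ∈ E, y ∈ R ∨ -y ∈ R) ∧ x ∉ R := by
  obtain ⟨Y, hXY, hYE, hYc, hxY, hYt⟩ := om_halfspace h hX hxE hx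
  have hFE : Y ∩ -Y ⊆ E := Set.inter_subset_left.trans hYE
  have hFc : d (Y ∩ -Y) ⊆ Y ∩ -Y := by
    intro u hu
    refine ⟨hYc (h.cx_mono _ _ Set.inter_subset_left hYE hu), ?_⟩
    have := h.cx_mono _ _ (Set.inter_subset_right (s := Y)) (om_negset h hYE) hu
    rw [h.cx_neg Y hYE] at this
    exact hYc this
  obtain ⟨T, hXT, hTF, hTc, hTa, hTt⟩ := om_tope_in h (X := X ∩ (Y ∩ -Y)) hFE hFc
    (fun y hy => ⟨hy.2, by simpa using hy.1⟩) Set.inter_subset_right (by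
      intro y hy hny
      exact hasym y (h.cx_mono _ _ Set.inter_subset_left hX hy)
        (h.cx_mono _ _ Set.inter_subset_left hX hny))
  have hTY : T ⊆ Y := hTF.trans Set.inter_subset_left
  have hTE := hTF.trans hFE
  have key : ∀ S : Set V, S.Finite → S ⊆ Y \ -Y → ∀ z ∈ Y ∩ -Y, z ∈ d (T ∪ S) → z ∈ T := by
    intro S hS
    induction S, hS using Set.Finite.induction_on with
    | empty => intro _ z _ hz; exact hTc (by simpa using hz)
    | @insert r S hr hS ih =>
      intro hSY z hz hzd
      have hSY' : S ⊆ Y \ -Y := (Set.subset_insert _ _).trans hSY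
      have hrY := hSY (Set.mem_insert _ _)
      apply ih hSY' z hz
      by_contra hcon
      have hTS : T ∪ S ⊆ Y := Set.union_subset hTY (hSY'.trans Set.sdiff_subset)
      have e1 : T ∪ insert r S = (T ∪ S) ∪ {-(-r)} := by
        ext u; simp
      rw [e1] at hzd
      have h3 := h.exchange3 _ (hTS.trans hYE) z (hFE hz) (-r) (h.neg_mem _ (hYE hrY.1)) hzd hcon
      refine hrY.2 (hYc (h.cx_mono _ _ ?_ hYE h3))
      exact Set.union_subset (Set.sdiff_subset.trans hTS) (by simpa using hz.2)
  have hRY : (Y \ -Y) ∪ T ⊆ Y := Set.union_subset Set.sdiff_subset hTY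
  refine ⟨(Y \ -Y) ∪ T, ?_, hRY.trans hYE, ?_, ?_, ?_, fun hh => hxY (hRY hh)⟩
  · intro u hu
    by_cases hu' : u ∈ -Y
    · exact Or.inr (hXT ⟨hu, hXY hu, hu'⟩)
    · exact Or.inl ⟨hXY hu, hu'⟩
  · intro z hz
    have hzY : z ∈ Y := hYc (h.cx_mono _ _ hRY hYE hz)
    by_cases hz' : z ∈ -Y
    · right
      obtain ⟨Z, hZ, hZf, hzZ⟩ := h.finitary _ (hRY.trans hYE) z hz
      refine key (Z ∩ (Y \ -Y)) (hZf.inter_of_left _) Set.inter_subset_right z ⟨hzY, hz'⟩ ?_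
      refine h.cx_mono _ _ ?_ (Set.union_subset hTE
        (Set.inter_subset_right.trans (Set.sdiff_subset.trans hYE))) hzZ
      intro u hu
      rcases hZ hu with h1 | h1
      · exact Or.inr ⟨hu, h1⟩
      · exact Or.inl h1
    · exact Or.inl ⟨hzY, hz'⟩
  · rintro y (hy | hy) hny
    · exact hy.2 (hRY hny)
    · rcases hny with h1 | h1
      · exact h1.2 (by simpa using hTY hy)
      · exact hTa y hy h1
  · intro y hy
    by_cases h1 : y ∈ Y
    · by_cases h2 : -y ∈ Y
      · rcases hTt y ⟨h1, h2⟩ with h3 | h3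
        · exact Or.inl (Or.inr h3)
        · exact Or.inr (Or.inr h3)
      · exact Or.inl (Or.inl ⟨h1, h2⟩)
    · have h2 := (hYt y hy).resolve_left h1
      exact Or.inr (Or.inl ⟨h2, by simpa using h1⟩)

end OM

section Cone

lemma cone_eq_hull (X : Set V) : cone X = (PointedCone.hull ℝ X : Set V) := by
  ext v
  constructor
  · rintro ⟨n, c, x, hc, hx, rfl⟩
    refine Submodule.sum_mem _ fun i _ => ?_
    exact PointedCone.smul_mem _ (hc i) (PointedCone.subset_hull (hx i))
  · intro hv
    obtain ⟨n, f, g, rfl⟩ := Submodule.mem_span_set'.1 hv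
    exact ⟨n, fun i => (f i : ℝ), fun i => (g i : V), fun i => (f i).2, fun i => (g i).2, rfl⟩

lemma subset_cone (X : Set V) : X ⊆ cone X := by
  rw [cone_eq_hull]; exact PointedCone.subset_hull

lemma cone_mono {X Y : Set V} (h : X ⊆ Y) : cone X ⊆ cone Y := by
  rw [cone_eq_hull, cone_eq_hull]; exact Submodule.span_mono h

lemma cone_trans {X Y : Set V} (h : X ⊆ cone Y) : cone X ⊆ cone Y := by
  rw [cone_eq_hull] at h
  rw [cone_eq_hull, cone_eq_hull]; exact Submodule.span_le.2 h

lemma cone_sub_span (X : Set V) : cone X ⊆ (Submodule.span ℝ X : Set V) := by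
  rw [cone_eq_hull]; exact PointedCone.hull_le_span ℝ X

lemma neg_mem_cone {X : Set V} {v : V} (hv : v ∈ cone X) : -v ∈ cone (-X) := by
  obtain ⟨n, c, x, hc, hx, rfl⟩ := hv
  exact ⟨n, c, fun i => -x i, hc, fun i => by simpa using hx i, by simp⟩

lemma sum_mem_cone {X : Set V} (t : Finset V) (f : V → ℝ) (g : V → V)
    (h : ∀ x ∈ t, 0 ≤ f x ∧ g x ∈ cone X) : ∑ x ∈ t, f x • g x ∈ cone X := by
  rw [cone_eq_hull] at *
  exact Submodule.sum_mem _ fun x hx => PointedCone.smul_mem _ (h x hx).1 (h x hx).2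

lemma mem_cone_finset {X : Set V} {v : V} (hv : v ∈ cone X) :
    ∃ (t : Finset V) (f : V → ℝ), (t : Set V) ⊆ X ∧ (∀ x ∈ t, 0 ≤ f x) ∧
      v = ∑ x ∈ t, f x • x := by
  rw [cone_eq_hull] at hv
  obtain ⟨c, hc, h0, rfl⟩ := PointedCone.mem_hull_set.1 hv
  exact ⟨c.support, c, hc, fun x _ => h0 x, rfl⟩

lemma caratheodory_aux (n : ℕ) : ∀ (t : Finset V) (f : V → ℝ), t.card = n → (∀ x ∈ t, 0 ≤ f x) →
    ∃ s : Finset V, s ⊆ t ∧ LinearIndepOn ℝ id (s : Set V) ∧ ∑ x ∈ t, f x • x ∈ cone (s : Set V) := by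
  classical
  induction n with
  | zero =>
    intro t f ht hf
    rw [Finset.card_eq_zero] at ht
    subst ht
    exact ⟨∅, le_rfl, by simp, sum_mem_cone _ _ _ (by simp)⟩
  | succ n ih =>
    intro t f ht hf
    by_cases hli : LinearIndepOn ℝ id (t : Set V)
    · exact ⟨t, le_rfl, hli, sum_mem_cone _ _ _ fun x hx => ⟨hf x hx, subset_cone _ hx⟩⟩
    obtain ⟨g, hg0, i, hit, hgi⟩ : ∃ g : V → ℝ, ∑ x ∈ t, g x • x = 0 ∧ ∃ i ∈ t, 0 < g i := by
      rw [linearIndepOn_finset_iff] at hli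
      push Not at hli
      obtain ⟨g, hg, i, hi, hgi⟩ := hli
      rcases lt_or_gt_of_ne hgi with h | h
      · exact ⟨fun x => - g x, by simpa using hg, i, hi, by simpa using h⟩
      · exact ⟨g, by simpa using hg, i, hi, h⟩
    obtain ⟨i₀, hi₀, hmin⟩ := (t.filter fun x => 0 < g x).exists_min_image (fun z => f z / g z)
      ⟨i, by simp [hit, hgi]⟩
    simp only [Finset.mem_filter] at hi₀ hmin
    set k : V → ℝ := fun z => f z - f i₀ / g i₀ * g z with hk
    have hk0 : k i₀ = 0 := by simp [hk, hi₀.2.ne']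
    have hkn : ∀ x ∈ t, 0 ≤ k x := by
      intro x hx
      simp only [hk, sub_nonneg]
      by_cases hgx : 0 < g x
      · rw [← le_div_iff₀ hgx]; exact hmin x ⟨hx, hgx⟩
      · exact (mul_nonpos_of_nonneg_of_nonpos (div_nonneg (hf _ hi₀.1) hi₀.2.le)
          (not_lt.1 hgx)).trans (hf x hx)
    have hsum : ∑ x ∈ t, f x • x = ∑ x ∈ t.erase i₀, k x • x := by
      rw [Finset.sum_erase _ (by rw [hk0, zero_smul])]
      simp only [hk, sub_smul, mul_smul, Finset.sum_sub_distrib, ← Finset.smul_sum, hg0, smul_zero,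
        sub_zero]
    obtain ⟨s, hs, hsl, hsc⟩ := ih (t.erase i₀) k (by rw [Finset.card_erase_of_mem hi₀.1, ht]; rfl)
      (fun x hx => hkn x (Finset.mem_of_mem_erase hx))
    exact ⟨s, hs.trans (Finset.erase_subset _ _), hsl, hsum ▸ hsc⟩

lemma cone_caratheodory {X : Set V} {v : V} (hv : v ∈ cone X) :
    ∃ s : Finset V, (s : Set V) ⊆ X ∧ LinearIndepOn ℝ id (s : Set V) ∧ v ∈ cone (s : Set V) := by
  obtain ⟨t, f, htX, hf, rfl⟩ := mem_cone_finset hv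
  obtain ⟨s, hs, h1, h2⟩ := caratheodory_aux _ t f rfl hf
  exact ⟨s, (Finset.coe_subset.2 hs).trans htX, h1, h2⟩

lemma mem_cone_pm {X : Set V} {v : V} (hv : v ∈ Submodule.span ℝ X) : v ∈ cone (X ∪ -X) := by
  induction hv using Submodule.span_induction with
  | mem x hx => exact subset_cone _ (Or.inl hx)
  | zero => rw [cone_eq_hull]; exact Submodule.zero_mem _
  | add x y _ _ hx hy => rw [cone_eq_hull] at *; exact Submodule.add_mem _ hx hy
  | smul a x _ hx =>
    rcases le_total 0 a with h | h
    · rw [cone_eq_hull] at *; exact PointedCone.smul_mem _ h hx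
    · have hx' := neg_mem_cone hx
      rw [Set.union_neg, neg_neg, Set.union_comm] at hx'
      rw [cone_eq_hull] at *
      have := PointedCone.smul_mem _ (neg_nonneg.2 h) hx'
      simpa using this

/-- The cone over a linearly independent set is pointed. -/
lemma cone_pointed {D : Set V} (hD : LinearIndepOn ℝ id D) (hfin : D.Finite) {p q : V}
    (hp : p ∈ cone D) (hq : q ∈ cone D) (h : p + q = 0) : p = 0 := by
  classical
  have rep : ∀ v ∈ cone D, ∃ f : V → ℝ, (∀ x, 0 ≤ f x) ∧ v = ∑ x ∈ hfin.toFinset, f x • x := by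
    intro v hv
    rw [cone_eq_hull] at hv
    obtain ⟨c, hc, h0, rfl⟩ := PointedCone.mem_hull_set.1 hv
    refine ⟨c, h0, ?_⟩
    refine Finset.sum_subset (fun x hx => by simpa using hc hx) ?_
    intro x _ hx
    simp [Finsupp.notMem_support_iff.1 hx]
  obtain ⟨f, hf, rfl⟩ := rep p hp
  obtain ⟨g, hg, rfl⟩ := rep q hq
  rw [← Finset.sum_add_distrib] at h
  simp only [← add_smul] at h
  have hD' : LinearIndepOn ℝ id (hfin.toFinset : Set V) := by simpa using hD
  rw [linearIndepOn_finset_iff] at hD'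
  have := hD' (fun x => f x + g x) (by simpa using h)
  refine Finset.sum_eq_zero fun x hx => ?_
  have h1 := this x hx
  have h2 := hf x
  have h3 := hg x
  have : f x = 0 := by linarith
  rw [this, zero_smul]

end Cone

section Main
variable {B : LinearMap.BilinForm ℝ V} {Δ : Set V} {d : Set V → Set V}

lemma posRoots_eq (hbrs : IsBasedRootSystem B Δ) (hclean : IsClean B Δ)
    (hneg : ∀ x ∈ rootSystem B Δ, -x ∈ rootSystem B Δ)
    (hne : ∀ x ∈ rootSystem B Δ, -x ≠ x) :
    ∀ y ∈ rootSystem B Δ, y ∈ positiveRoots B Δ ∨ -y ∈ positiveRoots B Δ := by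
  have ht := hclean (positiveRoots B Δ) le_rfl
    ⟨fun _ _ _ _ γ hγ _ => hγ, fun α hα => absurd hα.1 hα.2⟩
  simp only [sdiff_self, Set.neg_empty, Set.union_empty] at ht
  obtain ⟨-, -, -, hmax⟩ := ht
  intro y hy
  by_cases hyp : y ∈ positiveRoots B Δ
  · exact Or.inl hyp
  right
  by_contra hny
  have := hmax (cone (insert y Δ) ∩ rootSystem B Δ) Set.inter_subset_right
    (fun u hu => ⟨cone_trans Set.inter_subset_left hu.1, hu.2⟩) ?_
    (fun u hu => ⟨cone_mono (Set.subset_insert _ _) hu.2, hu.1⟩)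
  · apply hyp
    rw [← this]
    exact ⟨subset_cone _ (Set.mem_insert _ _), hy⟩
  · intro u hu hnu
    have h1 := hu.1
    have h2 := hnu.1
    rw [cone_eq_hull, SetLike.mem_coe] at h1 h2
    obtain ⟨a, p, hp, hup⟩ := Submodule.mem_span_insert.1 h1
    obtain ⟨b, q, hq, huq⟩ := Submodule.mem_span_insert.1 h2
    have ha : (0:ℝ) ≤ a := a.2
    have hb : (0:ℝ) ≤ b := b.2
    have hup' : u = (a : ℝ) • y + p := hup
    have huq' : -u = (b : ℝ) • y + q := huq
    have hsum : ((a : ℝ) + b) • y + (p + q) = 0 := by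
      have : u + -u = 0 := add_neg_cancel u
      rw [huq', hup'] at this
      rw [add_smul, ← this]; abel
    by_cases hab : (a : ℝ) + b = 0
    · have ha0 : (a : ℝ) = 0 := by linarith
      have hpq : p + q = 0 := by simpa [hab] using hsum
      have hp0 : p = 0 := cone_pointed (D := Δ) hbrs.indep hbrs.finite
        (by rw [cone_eq_hull]; exact hp) (by rw [cone_eq_hull]; exact hq) hpq
      have : u = 0 := by rw [hup', ha0, hp0]; simp
      exact hne u hu.2 (by rw [this]; simp)
    · have hpos : 0 < (a : ℝ) + b := lt_of_le_of_ne (by linarith) (Ne.symm hab)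
      have hyeq : -y = ((a : ℝ) + b)⁻¹ • (p + q) := by
        have : p + q = -(((a : ℝ) + b) • y) := by
          rw [eq_neg_iff_add_eq_zero, add_comm]; exact hsum
        rw [this, smul_neg, smul_smul, inv_mul_cancel₀ hab, one_smul]
      apply hny
      refine ⟨hneg y hy, ?_⟩
      rw [hyeq, cone_eq_hull]
      exact PointedCone.smul_mem _ (inv_nonneg.2 hpos.le) (Submodule.add_mem _ hp hq)

lemma roots_sub_span (hpos : ∀ y ∈ rootSystem B Δ, y ∈ positiveRoots B Δ ∨ -y ∈ positiveRoots B Δ) :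
    rootSystem B Δ ⊆ (Submodule.span ℝ Δ : Set V) := by
  intro y hy
  rcases hpos y hy with h | h
  · exact cone_sub_span _ h.2
  · have := cone_sub_span _ h.2
    simpa using this

lemma card_le_three [FiniteDimensional ℝ V] (hfin : Δ.Finite) (hrank : Δ.ncard = 3) {t : Finset V}
    (ht : (t : Set V) ⊆ (Submodule.span ℝ Δ : Set V)) (hli : LinearIndepOn ℝ id (t : Set V)) :
    t.card ≤ 3 := by
  have h1 : Module.finrank ℝ (Submodule.span ℝ (t : Set V)) = t.card :=
    finrank_span_finset_eq_card hli
  have h2 : Module.finrank ℝ (Submodule.span ℝ (t : Set V)) ≤ Module.finrank ℝ (Submodule.span ℝ Δ) :=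
    Submodule.finrank_mono (Submodule.span_le.2 ht)
  have h3 : Module.finrank ℝ (Submodule.span ℝ Δ) ≤ 3 := by
    have := finrank_span_finset_le_card (R := ℝ) hfin.toFinset
    rw [← Set.ncard_eq_toFinset_card Δ hfin, hrank] at this
    rw [Set.Finite.coe_toFinset] at this
    exact this
  omega

lemma rank_two_finset (hd : IsOMRS B Δ d) {t : Finset V} (ht : (t : Set V) ⊆ rootSystem B Δ)
    (hc : t.card ≤ 2) : d t = cone (t : Set V) ∩ rootSystem B Δ := by
  refine hd.rank_two _ ht ((rank_span_finset_le t).trans ?_)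
  exact_mod_cast hc

lemma tope_cone_closed (hclean : IsClean B Δ) (hd : IsOMRS B Δ d)
    (hpos : ∀ y ∈ rootSystem B Δ, y ∈ positiveRoots B Δ ∨ -y ∈ positiveRoots B Δ)
    {R : Set V} (hR : R ⊆ rootSystem B Δ) (hRc : d R ⊆ R) (hRa : ∀ y ∈ R, -y ∉ R)
    (hRt : ∀ y ∈ rootSystem B Δ, y ∈ R ∨ -y ∈ R) : cone R ∩ rootSystem B Δ ⊆ R := by
  classical
  have two : ∀ α ∈ R, ∀ β ∈ R, ∀ γ ∈ rootSystem B Δ, γ ∈ cone {α, β} → γ ∈ R := by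
    intro α hα β hβ γ hγ hc
    have hs : ((({α, β} : Finset V)) : Set V) ⊆ R := by
      intro u hu
      simp at hu
      rcases hu with rfl | rfl <;> assumption
    have := rank_two_finset hd (hs.trans hR) Finset.card_le_two
    refine hRc (hd.om.cx_mono _ _ hs hR ?_)
    rw [this]
    exact ⟨by simpa using hc, hγ⟩
  have hbi : C2Biclosed (positiveRoots B Δ) (R ∩ positiveRoots B Δ) := by
    constructor
    · intro α hα β hβ γ hγ hc
      exact ⟨two α hα.1 β hβ.1 γ hγ.1 hc, hγ⟩
    · intro α hα β hβ γ hγ hc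
      refine ⟨hγ, fun hγR => ?_⟩
      have h1 : -α ∈ R := (hRt α hα.1.1).resolve_left fun hh => hα.2 ⟨hh, hα.1⟩
      have h2 : -β ∈ R := (hRt β hβ.1.1).resolve_left fun hh => hβ.2 ⟨hh, hβ.1⟩
      have h3 := neg_mem_cone hc
      have e : -({α, β} : Set V) = {-α, -β} := by ext; simp
      rw [e] at h3
      exact hRa γ hγR.1 (two _ h1 _ h2 _ (hd.om.neg_mem _ hγ.1) h3)
  have ht := hclean _ Set.inter_subset_right hbi
  have hReq : R ∩ positiveRoots B Δ ∪ -(positiveRoots B Δ \ (R ∩ positiveRoots B Δ)) = R := by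
    ext u
    constructor
    · rintro (hu | hu)
      · exact hu.1
      · have hu1 : -u ∈ positiveRoots B Δ := hu.1
        have hu2 : -u ∉ R := fun hh => hu.2 ⟨hh, hu1⟩
        have := (hRt (-u) hu1.1).resolve_left hu2
        simpa using this
    · intro hu
      rcases hpos u (hR hu) with h | h
      · exact Or.inl ⟨hu, h⟩
      · exact Or.inr ⟨h, fun hh => hRa u hu hh.1⟩
  rw [hReq] at ht
  exact ht.2.1

lemma indep_asymm (hd : IsOMRS B Δ d) (n : ℕ) (hn : n ≤ 3) : ∀ t : Finset V, t.card = n →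
    (t : Set V) ⊆ rootSystem B Δ → LinearIndepOn ℝ id (t : Set V) →
    ∀ y ∈ d (t : Set V), -y ∉ d (t : Set V) := by
  classical
  induction n with
  | zero =>
    intro t ht _ _ y hy
    rw [Finset.card_eq_zero] at ht
    subst ht
    rw [Finset.coe_empty, hd.reduced.1] at hy
    exact absurd hy (Set.notMem_empty _)
  | succ n ih =>
    intro t ht htE hli
    have h := hd.om
    obtain ⟨α, hα⟩ : t.Nonempty := Finset.card_pos.1 (by omega)
    have hsE : ((t.erase α : Finset V) : Set V) ⊆ rootSystem B Δ :=
      (Finset.coe_subset.2 (Finset.erase_subset _ _)).trans htE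
    have hcard : (t.erase α).card = n := by rw [Finset.card_erase_of_mem hα, ht]; rfl
    have hsl : LinearIndepOn ℝ id ((t.erase α : Finset V) : Set V) :=
      hli.mono (Finset.coe_subset.2 (Finset.erase_subset _ _))
    have hαE : α ∈ rootSystem B Δ := htE hα
    have hins : (t : Set V) = ((t.erase α : Finset V) : Set V) ∪ {α} := by
      ext u
      by_cases hu : u = α <;> simp [hu, hα]
    have key : ∀ y, y ∈ d (t : Set V) → -y ∈ d (t : Set V) →
        y ∈ d ((t.erase α : Finset V) : Set V) := by
      intro y hy hny
      by_contra hcon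
      have hyE := h.cx_le_ground _ htE hy
      have h3 := h.exchange3 _ hsE y hyE (-α) (h.neg_mem _ hαE)
        (by rw [neg_neg, ← hins]; exact hy) hcon
      have h4 : -α ∈ d (t : Set V) := by
        refine om_tr h htE ?_ h3
        rintro v (hv | hv)
        · exact h.le_cx _ htE (Finset.erase_subset _ _ hv.1)
        · rw [Set.mem_singleton_iff.1 hv]; exact hny
      rw [hins] at h4
      have h5 := h.exchange2 _ hsE (-α) (h.neg_mem _ hαE) (by rw [neg_neg]; exact h4)
      rw [rank_two_finset hd hsE (by omega)] at h5
      have h6 := cone_sub_span _ h5.1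
      rw [SetLike.mem_coe, Submodule.neg_mem_iff] at h6
      have hli' := hli
      rw [hins, Set.union_singleton, linearIndepOn_id_insert (by simp)] at hli'
      exact hli'.2 h6
    intro y hy hny
    exact ih (by omega) _ hcard hsE hsl y (key y hy hny) (key (-y) hny (by rwa [neg_neg]))

lemma cone_sub_d [FiniteDimensional ℝ V] (hbrs : IsBasedRootSystem B Δ) (hrank : Δ.ncard = 3)
    (hclean : IsClean B Δ) (hd : IsOMRS B Δ d)
    (hpos : ∀ y ∈ rootSystem B Δ, y ∈ positiveRoots B Δ ∨ -y ∈ positiveRoots B Δ)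
    {X : Set V} (hX : X ⊆ rootSystem B Δ) : cone X ∩ rootSystem B Δ ⊆ d X := by
  rintro x ⟨hxc, hxE⟩
  obtain ⟨s, hsX, hsl, hxs⟩ := cone_caratheodory hxc
  have hsE := hsX.trans hX
  refine hd.om.cx_mono _ _ hsX hX ?_
  by_contra hcon
  have hcard := card_le_three hbrs.finite hrank (hsE.trans (roots_sub_span hpos)) hsl
  obtain ⟨R, hsR, hRE, hRc, hRa, hRt, hxR⟩ := om_sep_tope hd.om hsE hxE hcon
    (indep_asymm hd _ hcard s rfl hsE hsl)
  exact hxR (tope_cone_closed hclean hd hpos hRE hRc hRa hRt ⟨cone_mono hsR hxs, hxE⟩)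

lemma d_sub_cone [FiniteDimensional ℝ V] (hbrs : IsBasedRootSystem B Δ) (hrank : Δ.ncard = 3)
    (hclean : IsClean B Δ) (hd : IsOMRS B Δ d)
    (hpos : ∀ y ∈ rootSystem B Δ, y ∈ positiveRoots B Δ ∨ -y ∈ positiveRoots B Δ)
    {X : Set V} (hX : X ⊆ rootSystem B Δ) : d X ⊆ cone X := by
  classical
  intro z hz
  have h := hd.om
  have hzE := h.cx_le_ground X hX hz
  have hspan := roots_sub_span hpos
  -- choose a minimal finite subset
  obtain ⟨Y, hYX, hYf, hzY⟩ := h.finitary X hX z hz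
  have hex : ∃ n : ℕ, ∃ t : Finset V, (t : Set V) ⊆ X ∧ z ∈ d (t : Set V) ∧ t.card = n :=
    ⟨_, hYf.toFinset, by simpa using hYX, by simpa using hzY, rfl⟩
  obtain ⟨t, htX, hzt, htn⟩ := Nat.find_spec hex
  have hmin0 := fun m hm => Nat.find_min hex (m := m) hm
  have htE := htX.trans hX
  have hmin : ∀ e ∈ (t : Set V), z ∉ d ((t : Set V) \ {e}) := by
    intro e he hze
    refine hmin0 (t.erase e).card ?_ ⟨t.erase e, ?_, ?_, rfl⟩
    · rw [← htn]; exact Finset.card_erase_lt_of_mem he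
    · exact (Finset.coe_subset.2 (Finset.erase_subset _ _)).trans htX
    · rw [Finset.coe_erase]; exact hze
  -- `z` is not in the flat spanned by a proper subset
  have hflat : ∀ e ∈ (t : Set V), z ∉ d (((t : Set V) \ {e}) ∪ -((t : Set V) \ {e})) := by
    intro e he hze
    refine om_minimal h htE hzE hzt hmin t.finite_toSet le_rfl e he ?_
    refine h.cx_mono _ _ ?_ (Set.union_subset (Set.sdiff_subset.trans htE) (om_negset h htE)) hze
    exact Set.union_subset_union_right _ (Set.neg_subset_neg.2 Set.sdiff_subset)
  have hpmE : ∀ e, ((t : Set V) \ {e}) ∪ -((t : Set V) \ {e}) ⊆ rootSystem B Δ := fun e =>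
    Set.union_subset (Set.sdiff_subset.trans htE) (om_negset h (Set.sdiff_subset.trans htE))
  -- `t` is linearly independent
  have hli : LinearIndepOn ℝ id (t : Set V) := by
    by_contra hdep
    obtain ⟨e, he, hes⟩ : ∃ e ∈ (t : Set V), e ∈ Submodule.span ℝ ((t : Set V) \ {e}) := by
      rw [linearIndepOn_iff_notMem_span] at hdep
      push Not at hdep
      simpa using hdep
    refine hflat e he (om_tr h (hpmE e) ?_ hzt)
    intro u hu
    by_cases hue : u = e
    · rw [hue]
      exact cone_sub_d hbrs hrank hclean hd hpos (hpmE e) ⟨mem_cone_pm hes, htE he⟩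
    · exact h.le_cx _ (hpmE e) (Or.inl ⟨hu, hue⟩)
  refine cone_mono htX ?_
  by_cases hc2 : t.card ≤ 2
  · rw [rank_two_finset hd htE hc2] at hzt
    exact hzt.1
  -- `t` spans
  have hzs : z ∈ Submodule.span ℝ (t : Set V) := by
    by_contra hcon
    have hli2 : LinearIndepOn ℝ id ((insert z t : Finset V) : Set V) := by
      rw [Finset.coe_insert]; exact hli.id_insert hcon
    have hzt' : z ∉ t := fun hh => hcon (Submodule.subset_span hh)
    have := card_le_three hbrs.finite hrank (t := insert z t) (by
      rw [Finset.coe_insert]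
      exact Set.insert_subset (hspan hzE) (htE.trans hspan)) hli2
    rw [Finset.card_insert_of_notMem hzt'] at this
    omega
  obtain ⟨a, -, ha⟩ := Submodule.mem_span_finset.1 hzs
  rw [← ha]
  refine sum_mem_cone t a id fun e he => ⟨?_, subset_cone _ he⟩
  by_contra! hneg
  have heE : e ∈ rootSystem B Δ := htE he
  have hsE : (t : Set V) \ {e} ⊆ rootSystem B Δ := Set.sdiff_subset.trans htE
  -- exchange
  have h3 := h.exchange3 _ hsE z hzE (-e) (h.neg_mem _ heE) (by
    rw [neg_neg, Set.sdiff_union_self, Set.union_eq_left.2 (by simpa using he)]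
    exact hzt) (hmin e he)
  have hG : (((t : Set V) \ {e}) ∪ -((t : Set V) \ {e})) ∪ {-z} ⊆ rootSystem B Δ :=
    Set.union_subset (hpmE e) (by simpa using h.neg_mem z hzE)
  have h4 : -e ∈ d ((((t : Set V) \ {e}) ∪ -((t : Set V) \ {e})) ∪ {-z}) := by
    refine h.cx_mono _ _ ?_ hG h3
    exact Set.union_subset_union_left _ (Set.sdiff_subset.trans Set.subset_union_left)
  have hHE : (((t : Set V) \ {e}) ∪ -((t : Set V) \ {e})) ∪ {-e} ⊆ rootSystem B Δ :=
    Set.union_subset (hpmE e) (by simpa using h.neg_mem e heE)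
  have h5 : z ∈ cone ((((t : Set V) \ {e}) ∪ -((t : Set V) \ {e})) ∪ {-e}) := by
    rw [← ha, ← Finset.add_sum_erase t _ he]
    have h6 : ∑ x ∈ t.erase e, a x • x ∈ Submodule.span ℝ ((t : Set V) \ {e}) := by
      refine Submodule.sum_mem _ fun x hx => Submodule.smul_mem _ _ (Submodule.subset_span ?_)
      rw [Finset.mem_erase] at hx
      exact ⟨hx.2, hx.1⟩
    have h7 := cone_mono (Set.subset_union_left (t := {-e})) (mem_cone_pm h6)
    have h8 := subset_cone ((((t : Set V) \ {e}) ∪ -((t : Set V) \ {e})) ∪ {-e}) (Or.inr rfl)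
    rw [cone_eq_hull, SetLike.mem_coe] at *
    have h9 := PointedCone.smul_mem _ (neg_nonneg.2 hneg.le) h8
    rw [smul_neg, neg_smul, neg_neg] at h9
    exact Submodule.add_mem _ h9 h7
  have h6 := cone_sub_d hbrs hrank hclean hd hpos hHE ⟨h5, hzE⟩
  have h7 : z ∈ d ((((t : Set V) \ {e}) ∪ -((t : Set V) \ {e})) ∪ {-z}) := by
    refine om_tr h hG ?_ h6
    rintro v (hv | hv)
    · exact h.le_cx _ hG (Or.inl hv)
    · rw [Set.mem_singleton_iff.1 hv]; exact h4
  exact hflat e he (h.exchange2 _ (hpmE e) z hzE h7)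

end Main

/-- a clean rank 3 based root system has a unique OMRS structure:
any OMRS closure `d` coincides with the RRS closure `cone_Φ`. -/
theorem rank3_clean_unique_OMRS [FiniteDimensional ℝ V]
    (B : LinearMap.BilinForm ℝ V) (Δ : Set V)
    (hbrs : IsBasedRootSystem B Δ) (hrank : Δ.ncard = 3)
    (hclean : IsClean B Δ)
    (d : Set V → Set V) (hd : IsOMRS B Δ d) :
    ∀ X, X ⊆ rootSystem B Δ → d X = cone X ∩ rootSystem B Δ := by
  intro X hX
  have hpos := posRoots_eq hbrs hclean hd.om.neg_mem hd.om.neg_ne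
  exact Set.Subset.antisymm
    (fun z hz => ⟨d_sub_cone hbrs hrank hclean hd hpos hX hz, hd.om.cx_le_ground X hX hz⟩)
    (cone_sub_d hbrs hrank hclean hd hpos hX)
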